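/- Representation of the D^q-derivatives of the SRK stages and numerical solution by rooted trees: Let q∈ℕ, let a, b^1,…,b^m be q-times continuously differentiable, and assume the stage values H_i^{(k,ν)} and Y are q-times continuously differentiable functions of θ near 0 satisfying the stage equations identically. Then for every component index J, every i∈{1,…,s}, k∈{0,…,m}, ν∈M̄: D^q H_i^{(k,ν)}(t_0)^J = Σ over t∈LTS with l(t)=q of γ(t)·Σ_{i_1=1}^s Z_{i,i_1}^{(k,ν)}·Φ_{i_1}(t)·F(t)(Y(t_0))^J, and D^q Y(t_0)^J = Σ over t∈LTS with l(t)=q of γ(t)·Σ_{i_1=1}^s z_{i_1}·Φ_{i_1}(t)·F(t)(Y(t_0))^J, where all θ-derivatives are evaluated at θ=0, and Z_{i,i_1}^{(k,ν)} = Z_{i,i_1}^{(k,ν),(0,0)} and z_{i_1}=z_{i_1}^{(0,0)} if the root of t has colour τ, while Z_{i,i_1}^{(k,ν)} = Σ_{j_r=1}^m Σ_{ν_r∈M} Z_{i,i_1}^{(k,ν),(j_r,ν_r)} and z_{i_1}=Σ_{j_r=1}^m Σ_{ν_r∈M} z_{i_1}^{(j_r,ν_r)} if the root of t has colour σ_{j_r}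 (the index pair (j_r,ν_r) shared with the occurrences of the root as father inside Φ_{i_1}(t)). -/

import Mathlib

open scoped BigOperators
open Finset MeasureTheory ProbabilityTheory

noncomputable section

namespace SRKPaper

/-- `ℝ^d` with the Euclidean norm. -/
abbrev Evec (d : ℕ) : Type := EuclideanSpace ℝ (Fin d)

/-- The index pairs `(k,ν)` of the SRK method: `det` is `(0,0)`,
`sto k ν` is `(k,ν)` with `k ∈ {1,…,m}`, `ν ∈ M`. -/
inductive SIdx (m : ℕ) (M : Type) : Type where
  | det : SIdx m M
  | sto : Fin m → M → SIdx m M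

/-- `M̄ = M ∪ {0}`, with `none` playing the role of the index `0`. -/
abbrev Mbar (M : Type) : Type := Option M

/-- The real coefficients of an autonomous `s`-stage stochastic Runge–Kutta method. -/
structure SRK (m s : ℕ) (M : Type) : Type where
  α : Fin s → ℝ
  γc : M → SIdx m M → Fin s → ℝ
  A : SIdx m M → Fin s → Fin s → ℝ
  B : M → SIdx m M → Fin m → M → Fin s → Fin s → ℝ

variable {d m s : ℕ} {M : Type}

section SRKdefs
variable [Fintype M]

/-- θ-dependent weights `z^{(k,ν)}`. -/
def SRK.z (c : SRK m s M) (θ : Mbar M → ℝ) : SIdx m M → Fin s → ℝ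
  | .det => fun i => c.α i * θ none
  | .sto k ν => fun i => ∑ ι : M, c.γc ι (.sto k ν) i * θ (some ι)

/-- θ-dependent stage coefficients `Z^{(k,ν),(r,μ)}`; the first index is the
father pair `p = (k,ν)`, the second the son pair. -/
def SRK.Z (c : SRK m s M) (θ : Mbar M → ℝ) (p : SIdx m M) : SIdx m M → Fin s → Fin s → ℝ
  | .det => fun i j => c.A p i j * θ none
  | .sto r μ => fun i j => ∑ ι : M, c.B ι p r μ i j * θ (some ι)

/-- The stage equations of the autonomous SRK method with starting value `y0`. -/
def StageEq (c : SRK m s M) (a : Evec d → Evec d) (b : Fin m → Evec d → Evec d)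
    (y0 : Evec d) (θ : Mbar M → ℝ) (H : SIdx m M → Fin s → Evec d) : Prop :=
  ∀ (p : SIdx m M) (i : Fin s),
    H p i = y0 + (∑ j, c.Z θ p .det i j • a (H .det j))
      + ∑ j, ∑ r, ∑ μ, c.Z θ p (.sto r μ) i j • b r (H (.sto r μ) j)

/-- The one-step value `Y(t)` of the SRK method. -/
def oneStep (c : SRK m s M) (a : Evec d → Evec d) (b : Fin m → Evec d → Evec d)
    (y0 : Evec d) (θ : Mbar M → ℝ) (H : SIdx m M → Fin s → Evec d) : Evec d :=
  y0 + (∑ i, c.z θ .det i • a (H .det i))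
    + ∑ i, ∑ k, ∑ ν, c.z θ (.sto k ν) i • b k (H (.sto k ν) i)

end SRKdefs

/-- A monotonically labelled S-tree with `l+1` nodes: node `0` is the root, the
nonroot nodes are labelled `1,…,l` and are represented by `Fin l` (node `i : Fin l`
has true label `i+1`).  `father i` is the father of node `i+1` (a node label in
`Fin (l+1)`), and `color i` is the colour of node `i+1`: `none` is a deterministic
node `τ`, `some j` a stochastic node `σ_j` with (concrete) variable index `j`. -/
structure STree (l m : ℕ) : Type where
  father : Fin l → Fin (l + 1)
  color : Fin l → Option (Fin m)
  mono : ∀ i : Fin l, (father i).val ≤ i.val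

def STree.equivSubtype (l m : ℕ) :
    STree l m ≃ {p : (Fin l → Fin (l+1)) × (Fin l → Option (Fin m)) //
      ∀ i : Fin l, (p.1 i).val ≤ i.val} where
  toFun t := ⟨(t.father, t.color), t.mono⟩
  invFun p := ⟨p.1.1, p.1.2, p.2⟩
  left_inv t := rfl
  right_inv p := rfl

instance (l m : ℕ) : Fintype (STree l m) := Fintype.ofEquiv _ (STree.equivSubtype l m).symm

/-- The set of sons of the node with label `v`. -/
def STree.child {l m : ℕ} (t : STree l m) (v : Fin (l+1)) : Finset (Fin l) :=
  Finset.univ.filter fun i => t.father i = v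

/-- interpretation of a colour by the corresponding coefficient function (`b^0 = a`). -/
def nodeFun (a : Evec d → Evec d) (b : Fin m → Evec d → Evec d) :
    Option (Fin m) → Evec d → Evec d
  | none => a
  | some j => b j

/-- The elementary differential attached to the subtree rooted at the nonroot node `i`
(fuel-based recursion; the fuel `l` always suffices). -/
def elemFAux (a : Evec d → Evec d) (b : Fin m → Evec d → Evec d) {l : ℕ} (t : STree l m) :
    ℕ → Fin l → Evec d → Evec d
  | 0, _, _ => 0
  | fuel + 1, i, x =>
      iteratedFDeriv ℝ (t.child i.succ).card (nodeFun a b (t.color i)) x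
        fun p => elemFAux a b t fuel ((t.child i.succ).orderIsoOfFin rfl p).1 x

def elemF (a : Evec d → Evec d) (b : Fin m → Evec d → Evec d) {l : ℕ} (t : STree l m)
    (i : Fin l) : Evec d → Evec d := elemFAux a b t l i

/-- The elementary differential `F(t)(x)` of a tree whose root has colour `γ`
(representing the functional `f`). -/
def elemFRoot (f : Evec d → ℝ) (a : Evec d → Evec d) (b : Fin m → Evec d → Evec d)
    {l : ℕ} (t : STree l m) (x : Evec d) : ℝ :=
  iteratedFDeriv ℝ (t.child 0).card f x
    fun p => elemF a b t ((t.child 0).orderIsoOfFin rfl p).1 x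

/-- The elementary differential `F(t)(x)` of a tree whose root has colour `rc`
(`none = τ`, `some j = σ_j`). -/
def elemFRootV (a : Evec d → Evec d) (b : Fin m → Evec d → Evec d) (rc : Option (Fin m))
    {l : ℕ} (t : STree l m) (x : Evec d) : Evec d :=
  iteratedFDeriv ℝ (t.child 0).card (nodeFun a b rc) x
    fun p => elemF a b t ((t.child 0).orderIsoOfFin rfl p).1 x

/-- number of nodes of the subtree rooted at the nonroot node `i` (fuel-based). -/
def sizeAux {l m : ℕ} (t : STree l m) : ℕ → Fin l → ℕ
  | 0, _ => 0
  | fuel + 1, i => 1 + ∑ c ∈ t.child i.succ, sizeAux t fuel c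

def STree.size {l m : ℕ} (t : STree l m) (i : Fin l) : ℕ := sizeAux t l i

/-- density of the subtree rooted at the nonroot node `i`. -/
def densAux {l m : ℕ} (t : STree l m) : ℕ → Fin l → ℕ
  | 0, _ => 1
  | fuel + 1, i => t.size i * ∏ c ∈ t.child i.succ, densAux t fuel c

def STree.densNode {l m : ℕ} (t : STree l m) (i : Fin l) : ℕ := densAux t l i

/-- density `γ(t)` of a tree whose root has colour `γ`. -/
def STree.densDelta {l m : ℕ} (t : STree l m) : ℕ := ∏ c ∈ t.child 0, t.densNode c

/-- density `γ(t)` of a tree (with `l+1` nodes) whose root has colour `τ` or `σ_j`. -/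
def STree.densR {l m : ℕ} (t : STree l m) : ℕ := (l+1) * ∏ c ∈ t.child 0, t.densNode c

/-- number `s(t)` of stochastic nonroot nodes. -/
def STree.scount {l m : ℕ} (t : STree l m) : ℕ :=
  (Finset.univ.filter fun i : Fin l => (t.color i).isSome = true).card

/-- number `d(t)` of deterministic nonroot nodes. -/
def STree.dcount {l m : ℕ} (t : STree l m) : ℕ :=
  (Finset.univ.filter fun i : Fin l => t.color i = none).card

section PhiDefs
variable [Fintype M]

/-- The vector `Ψ^{(p)}` of the subtree rooted at the nonroot node `i`, where `p` is
the index pair of the father of `i` (fuel-based recursion). -/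
def PsiAux (c : SRK m s M) (θ : Mbar M → ℝ) {l : ℕ} (t : STree l m) :
    ℕ → Fin l → SIdx m M → Fin s → ℝ
  | 0, _, _, _ => 1
  | fuel + 1, i, p, q =>
    match t.color i with
    | none => ∑ j, c.Z θ p .det q j * ∏ cc ∈ t.child i.succ, PsiAux c θ t fuel cc .det j
    | some jj => ∑ μ : M, ∑ j, c.Z θ p (.sto jj μ) q j *
        ∏ cc ∈ t.child i.succ, PsiAux c θ t fuel cc (.sto jj μ) j

def PsiN (c : SRK m s M) (θ : Mbar M → ℝ) {l : ℕ} (t : STree l m)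
    (i : Fin l) (p : SIdx m M) (q : Fin s) : ℝ := PsiAux c θ t l i p q

/-- the elementary-weight factor contributed by the subtree rooted at a son of the root. -/
def phiFactor (c : SRK m s M) (θ : Mbar M → ℝ) {l : ℕ} (t : STree l m) (i : Fin l) : ℝ :=
  match t.color i with
  | none => ∑ j, c.z θ .det j * ∏ cc ∈ t.child i.succ, PsiN c θ t cc .det j
  | some jj => ∑ μ : M, ∑ j, c.z θ (.sto jj μ) j *
      ∏ cc ∈ t.child i.succ, PsiN c θ t cc (.sto jj μ) j

/-- The elementary weight `Φ_S(t)` of a `γ`-rooted tree. -/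
def PhiS (c : SRK m s M) (θ : Mbar M → ℝ) {l : ℕ} (t : STree l m) : ℝ :=
  ∏ i ∈ t.child 0, phiFactor c θ t i

/-- `∑_{i₁} Z^{(k,ν)}_{i,i₁} Φ_{i₁}(t)` for a tree with root colour `rc`, the sum over
the pair `(j_r,ν_r)` of the root being shared between the `Z`-factor and `Φ`. -/
def ZPhi (c : SRK m s M) (θ : Mbar M → ℝ) (p : SIdx m M) (i : Fin s)
    (rc : Option (Fin m)) {l : ℕ} (t : STree l m) : ℝ :=
  match rc with
  | none => ∑ i1, c.Z θ p .det i i1 * ∏ cc ∈ t.child 0, PsiN c θ t cc .det i1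
  | some jr => ∑ ν : M, ∑ i1, c.Z θ p (.sto jr ν) i i1 *
      ∏ cc ∈ t.child 0, PsiN c θ t cc (.sto jr ν) i1

/-- `∑_{i₁} z_{i₁} Φ_{i₁}(t)` for a tree with root colour `rc`. -/
def zPhi (c : SRK m s M) (θ : Mbar M → ℝ)
    (rc : Option (Fin m)) {l : ℕ} (t : STree l m) : ℝ :=
  match rc with
  | none => ∑ i1, c.z θ .det i1 * ∏ cc ∈ t.child 0, PsiN c θ t cc .det i1
  | some jr => ∑ ν : M, ∑ i1, c.z θ (.sto jr ν) i1 *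
      ∏ cc ∈ t.child 0, PsiN c θ t cc (.sto jr ν) i1

end PhiDefs

/-- `D^q` with increments `Δ` applied to `g` at the point `θ0`:
`∑_{ν₁,…,ν_q ∈ M̄} Δθ_{ν₁}⋯Δθ_{ν_q} ∂^q g/(∂θ_{ν₁}⋯∂θ_{ν_q})(θ0)`. -/
def Dq {ι : Type} [Fintype ι] [DecidableEq ι] {F : Type}
    [NormedAddCommGroup F] [NormedSpace ℝ F]
    (q : ℕ) (Δ : ι → ℝ) (g : (ι → ℝ) → F) (θ0 : ι → ℝ) : F :=
  ∑ νs : Fin q → ι, (∏ r, Δ (νs r)) •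
    iteratedFDeriv ℝ q g θ0 fun r => Pi.single (νs r) 1

/-- `∑_{ν₁,…,ν_q ∈ M̄} ∂^q g/(∂θ_{ν₁}⋯∂θ_{ν_q})(θ0)`. -/
def DerSum {ι : Type} [Fintype ι] [DecidableEq ι] {F : Type}
    [NormedAddCommGroup F] [NormedSpace ℝ F]
    (q : ℕ) (g : (ι → ℝ) → F) (θ0 : ι → ℝ) : F :=
  ∑ νs : Fin q → ι, iteratedFDeriv ℝ q g θ0 fun r => Pi.single (νs r) 1

/-- the space `C_P^l`: `l` times continuously differentiable with all derivatives up
to order `l` of polynomial growth. -/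
def IsCP {d : ℕ} {F : Type} [NormedAddCommGroup F] [NormedSpace ℝ F]
    (l : ℕ) (g : Evec d → F) : Prop :=
  ContDiff ℝ l g ∧ ∀ i : ℕ, i ≤ l → ∃ K > (0:ℝ), ∃ r : ℕ,
    ∀ x, ‖iteratedFDeriv ℝ i g x‖ ≤ K * (1 + ‖x‖ ^ (2*r))

/-- A labelled tree is special if no node except possibly the root has more than one son. -/
def IsSpecial {q : ℕ} (t : STree q 0) : Prop :=
  ∀ i : Fin q, (t.child i.succ).card ≤ 1

instance {q : ℕ} : DecidablePred (IsSpecial (q := q)) := fun t => by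
  unfold IsSpecial; infer_instance

end SRKPaper

namespace SRKPaper

section Calculus

variable {E F : Type} [NormedAddCommGroup E] [NormedSpace ℝ E]
  [NormedAddCommGroup F] [NormedSpace ℝ F]

theorem contDiffAt_deriv {n : ℕ} {f : ℝ → E} {x : ℝ} (hf : ContDiffAt ℝ (n + 1 : ℕ) f x) :
    ContDiffAt ℝ n (deriv f) x := by
  simpa using (hf.fderiv_right (m := n) (by norm_cast)).clm_apply (contDiffAt_const (c := (1 : ℝ)))

theorem eventually_differentiableAt {n : ℕ} {f : ℝ → E} {x : ℝ}
    (hf : ContDiffAt ℝ (n + 1 : ℕ) f x) : ∀ᶠ y in nhds x, DifferentiableAt ℝ f y :=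
  (hf.eventually (by simp)).mono fun y hy => hy.differentiableAt (by simp)

/-- Leibniz rule for the iterated derivative of a curve of linear maps applied to a curve,
with the sum running over the subsets of a finite set of order many elements. -/
theorem iteratedDeriv_clm_apply_eq_sum_powerset {α : Type} [DecidableEq α] (S : Finset α) :
    ∀ {L : ℝ → E →L[ℝ] F} {v : ℝ → E} {x : ℝ},
      ContDiffAt ℝ S.card L x → ContDiffAt ℝ S.card v x →
      iteratedDeriv S.card (fun s => L s (v s)) x =
        ∑ A ∈ S.powerset, iteratedDeriv (S \ A).card L x (iteratedDeriv A.card v x) := by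
  induction S using Finset.induction_on with
  | empty => intro L v x _ _; simp
  | insert i S hi ih =>
    intro L v x hL hv
    rw [card_insert_of_notMem hi] at hL hv ⊢
    have hL' := contDiffAt_deriv hL
    have hv' := contDiffAt_deriv hv
    have hL0 : ContDiffAt ℝ S.card L x := hL.of_le (by norm_cast; lia)
    have hv0 : ContDiffAt ℝ S.card v x := hv.of_le (by norm_cast; lia)
    have hd : deriv (fun s => L s (v s)) =ᶠ[nhds x]
        (fun s => deriv L s (v s)) + fun s => L s (deriv v s) := by
      filter_upwards [eventually_differentiableAt hL, eventually_differentiableAt hv] with y h1 h2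
      exact (h1.hasDerivAt.clm_apply h2.hasDerivAt).deriv
    rw [iteratedDeriv_succ', hd.iteratedDeriv_eq, iteratedDeriv_add (hL'.clm_apply hv0)
      (hL0.clm_apply hv'), ih hL' hv0, ih hL0 hv', sum_powerset_insert hi]
    congr 1
    · refine sum_congr rfl fun A hA => ?_
      have hiA : i ∉ A := fun h => hi (mem_powerset.1 hA h)
      rw [insert_sdiff_of_notMem _ hiA, card_insert_of_notMem (by simp [hi]), iteratedDeriv_succ']
    · refine sum_congr rfl fun A hA => ?_
      have hiA : i ∉ A := fun h => hi (mem_powerset.1 hA h)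
      rw [insert_sdiff_insert, card_insert_of_notMem hiA, iteratedDeriv_succ',
        sdiff_insert_of_notMem hi]

theorem iteratedDeriv_succ_id_smul {n : ℕ} {G : ℝ → E} (hG : ContDiffAt ℝ (n + 1 : ℕ) G 0) :
    iteratedDeriv (n + 1) (fun s => s • G s) 0 = ((n + 1 : ℕ) : ℝ) • iteratedDeriv n G 0 := by
  have h := iteratedDerivWithin_smul (Set.mem_univ (0 : ℝ)) uniqueDiffOn_univ
    (contDiffAt_id (𝕜 := ℝ) (n := (n + 1 : ℕ))).contDiffWithinAt hG.contDiffWithinAt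
  rw [iteratedDerivWithin_univ] at h
  refine h.trans ?_
  rw [sum_eq_single 1]
  · rw [Nat.cast_smul_eq_nsmul]
    simp [iteratedDerivWithin_univ, iteratedDeriv_id]
  · intro k _ hk
    simp [iteratedDerivWithin_univ, iteratedDeriv_id, hk]
  · simp

/-- The multilinear derivative of `g` at `x`, of order the cardinality of `A`, applied to the
vectors `v i` with `i ∈ A` in increasing order. -/
def finsetFDeriv {l : ℕ} (g : E → F) (x : E) (A : Finset (Fin l)) (v : Fin l → E) : F :=
  iteratedFDeriv ℝ A.card g x fun p => v (A.orderIsoOfFin rfl p).1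

theorem finsetFDeriv_congr {l : ℕ} (g : E → F) (x : E) {A : Finset (Fin l)} {v w : Fin l → E}
    (h : ∀ i ∈ A, v i = w i) : finsetFDeriv g x A v = finsetFDeriv g x A w := by
  unfold finsetFDeriv
  congr 1
  funext p
  exact h _ (A.orderIsoOfFin rfl p).2

theorem finsetFDeriv_empty {l : ℕ} (g : E → F) (x : E) (v : Fin l → E) :
    finsetFDeriv g x ∅ v = g x := by
  rw [finsetFDeriv, ← iteratedFDeriv_zero_apply (𝕜 := ℝ) (f := g) (x := x)]
  rfl

theorem iteratedFDeriv_cons {n : ℕ} : ∀ {F : Type} [NormedAddCommGroup F] [NormedSpace ℝ F]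
    {g : E → F} (_ : ContDiff ℝ (n + 1 : ℕ) g) (x w : E) (v : Fin n → E),
    iteratedFDeriv ℝ (n + 1) g x (Fin.cons w v : Fin (n + 1) → E) =
      iteratedFDeriv ℝ n (fderiv ℝ g) x v w := by
  induction n with
  | zero =>
    intro F _ _ g _ x w v
    rw [iteratedFDeriv_succ_apply_right]
    simp
  | succ n ih =>
    intro F _ _ g hg x w v
    have hg1 : ContDiff ℝ (n + 1 : ℕ) (fderiv ℝ g) := hg.fderiv_right (by norm_cast)
    have hg2 : ContDiff ℝ n (fderiv ℝ (fderiv ℝ g)) := hg1.fderiv_right (by norm_cast)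
    have hinit : Fin.init (Fin.cons w v : Fin (n + 2) → E)
        = (Fin.cons w (Fin.init v) : Fin (n + 1) → E) := by
      funext p
      refine Fin.cases ?_ (fun p => ?_) p
      · rfl
      · simp [Fin.init]
    have hlast : (Fin.cons w v : Fin (n + 2) → E) (Fin.last (n + 1)) = v (Fin.last n) := by
      rw [← Fin.succ_last, Fin.cons_succ]
    rw [iteratedFDeriv_succ_apply_right, hinit, hlast, ih hg1, iteratedFDeriv_succ_apply_right]
    have happly : ∀ u₁ u₂ : E,
        iteratedFDeriv ℝ n (fun y => fderiv ℝ (fderiv ℝ g) y u₁ u₂) x (Fin.init v) =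
          iteratedFDeriv ℝ n (fderiv ℝ (fderiv ℝ g)) x (Fin.init v) u₁ u₂ := by
      intro u₁ u₂
      have := (((ContinuousLinearMap.apply ℝ F u₂).comp
        (ContinuousLinearMap.apply ℝ (E →L[ℝ] F) u₁)).iteratedFDeriv_comp_left
          (hg2.contDiffAt (x := x)) le_rfl)
      exact congrArg (fun M => M (Fin.init v)) this
    rw [← happly, ← happly]
    congr 2
    funext y
    exact (hg.contDiffAt (x := y)).isSymmSndFDerivAt
      (by rw [minSmoothness_of_isRCLikeNormedField]; norm_cast; lia) _ _

theorem finsetFDeriv_insert {l : ℕ} {g : E → F} (x : E) {A : Finset (Fin l)} {i : Fin l}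
    (hg : ContDiff ℝ (A.card + 1 : ℕ) g) (hi : ∀ j ∈ A, i < j) (v : Fin l → E) :
    finsetFDeriv g x (insert i A) v = finsetFDeriv (fderiv ℝ g) x A v (v i) := by
  have hiA : i ∉ A := fun h => (hi i h).ne rfl
  have key : ∀ (n : ℕ) (B : Finset (Fin l)) (hB : B.card = n),
      finsetFDeriv g x B v = iteratedFDeriv ℝ n g x fun p => v (B.orderEmbOfFin hB p) := by
    rintro n B rfl; rfl
  have horder : ((insert i A).orderEmbOfFin (card_insert_of_notMem hiA) : Fin (A.card + 1) → Fin l)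
      = Fin.cons i (A.orderEmbOfFin rfl) := by
    symm
    apply orderEmbOfFin_unique
    · intro p
      refine Fin.cases ?_ (fun p => ?_) p <;> simp
    · intro p p'
      refine Fin.cases ?_ (fun p => ?_) p <;> refine Fin.cases ?_ (fun p' => ?_) p'
      · simp
      · intro _; simpa using hi _ (orderEmbOfFin_mem A rfl p')
      · simp
      · simp
  rw [key (A.card + 1) _ (card_insert_of_notMem hiA), horder, finsetFDeriv,
    ← iteratedFDeriv_cons hg]
  congr 1
  funext p
  refine Fin.cases ?_ (fun p => ?_) p <;> simp

end Calculus

section Recursion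

variable {d m s l : ℕ} {M : Type}

@[ext]
theorem STree.ext {t t' : STree l m} (hf : t.father = t'.father) (hc : t.color = t'.color) :
    t = t' := by
  cases t; cases t'; simp_all

theorem STree.mem_child {t : STree l m} {v : Fin (l + 1)} {i : Fin l} :
    i ∈ t.child v ↔ t.father i = v := by
  simp [STree.child]

theorem STree.lt_of_mem_child {t : STree l m} {i j : Fin l} (h : j ∈ t.child i.succ) : i < j := by
  have := t.mono j
  rw [STree.mem_child.1 h, Fin.val_succ] at this
  exact Fin.lt_def.2 this

theorem sizeAux_stable (t : STree l m) (n n' : ℕ) (i : Fin l) (hn : l ≤ n + i) (hn' : l ≤ n' + i) :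
    sizeAux t n i = sizeAux t n' i := by
  induction n generalizing n' i with
  | zero => have := i.2; lia
  | succ n ih =>
    cases n' with
    | zero => have := i.2; lia
    | succ n' =>
      simp only [sizeAux]
      congr 1
      refine sum_congr rfl fun c hc => ?_
      have := Fin.lt_def.1 (STree.lt_of_mem_child hc)
      exact ih n' c (by lia) (by lia)

theorem STree.size_eq (t : STree l m) (i : Fin l) :
    t.size i = 1 + ∑ c ∈ t.child i.succ, t.size c := by
  rw [STree.size, sizeAux_stable t l (l + 1) i (by lia) (by lia)]
  rfl

theorem densAux_stable (t : STree l m) (n n' : ℕ) (i : Fin l) (hn : l ≤ n + i) (hn' : l ≤ n' + i) :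
    densAux t n i = densAux t n' i := by
  induction n generalizing n' i with
  | zero => have := i.2; lia
  | succ n ih =>
    cases n' with
    | zero => have := i.2; lia
    | succ n' =>
      simp only [densAux]
      congr 1
      refine prod_congr rfl fun c hc => ?_
      have := Fin.lt_def.1 (STree.lt_of_mem_child hc)
      exact ih n' c (by lia) (by lia)

theorem STree.densNode_eq (t : STree l m) (i : Fin l) :
    t.densNode i = t.size i * ∏ c ∈ t.child i.succ, t.densNode c := by
  rw [STree.densNode, densAux_stable t l (l + 1) i (by lia) (by lia)]
  rfl

theorem elemFAux_succ (a : Evec d → Evec d) (b : Fin m → Evec d → Evec d) (t : STree l m)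
    (n : ℕ) (i : Fin l) (x : Evec d) :
    elemFAux a b t (n + 1) i x = finsetFDeriv (nodeFun a b (t.color i)) x (t.child i.succ)
      fun c => elemFAux a b t n c x := rfl

theorem elemFAux_stable (a : Evec d → Evec d) (b : Fin m → Evec d → Evec d) (t : STree l m)
    (x : Evec d) (n n' : ℕ) (i : Fin l) (hn : l ≤ n + i) (hn' : l ≤ n' + i) :
    elemFAux a b t n i x = elemFAux a b t n' i x := by
  induction n generalizing n' i with
  | zero => have := i.2; lia
  | succ n ih =>
    cases n' with
    | zero => have := i.2; lia
    | succ n' =>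
      rw [elemFAux_succ, elemFAux_succ]
      refine finsetFDeriv_congr _ _ fun c hc => ?_
      have := Fin.lt_def.1 (STree.lt_of_mem_child hc)
      exact ih n' c (by lia) (by lia)

theorem elemF_eq (a : Evec d → Evec d) (b : Fin m → Evec d → Evec d) (t : STree l m)
    (i : Fin l) (x : Evec d) :
    elemF a b t i x = finsetFDeriv (nodeFun a b (t.color i)) x (t.child i.succ)
      fun c => elemF a b t c x := by
  rw [elemF, elemFAux_stable a b t x l (l + 1) i (by lia) (by lia)]
  rfl

variable [Fintype M]

/-- The pairs of an index pair and a stage number that a node of a given colour sums over. -/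
def states (s : ℕ) : Option (Fin m) → Finset (SIdx m M × Fin s)
  | none => univ.map ⟨fun j => (.det, j), fun _ _ h => (Prod.ext_iff.1 h).2⟩
  | some r => (univ : Finset (M × Fin s)).map
      ⟨fun x => (.sto r x.1, x.2), fun x y h => by
        obtain ⟨h1, h2⟩ := Prod.ext_iff.1 h
        exact Prod.ext (SIdx.sto.inj h1).2 h2⟩

theorem sum_states_none {V : Type} [AddCommMonoid V] (f : SIdx m M × Fin s → V) :
    ∑ κ ∈ states s none, f κ = ∑ j, f (.det, j) := by
  rw [states, sum_map]
  rfl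

theorem sum_states_some {V : Type} [AddCommMonoid V] (r : Fin m) (f : SIdx m M × Fin s → V) :
    ∑ κ ∈ states s (some r), f κ = ∑ μ, ∑ j, f (.sto r μ, j) := by
  rw [states, sum_map, Fintype.sum_prod_type]
  rfl

theorem PsiAux_succ (c : SRK m s M) (θ : Mbar M → ℝ) (t : STree l m) (n : ℕ) (i : Fin l)
    (κ : SIdx m M × Fin s) :
    PsiAux c θ t (n + 1) i κ.1 κ.2 = ∑ κ' ∈ states s (t.color i), c.Z θ κ.1 κ'.1 κ.2 κ'.2 *
      ∏ j ∈ t.child i.succ, PsiAux c θ t n j κ'.1 κ'.2 := by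
  rw [PsiAux]
  cases t.color i with
  | none => rw [sum_states_none]
  | some r => rw [sum_states_some]

theorem PsiAux_stable (c : SRK m s M) (θ : Mbar M → ℝ) (t : STree l m)
    (n n' : ℕ) (i : Fin l) (κ : SIdx m M × Fin s) (hn : l ≤ n + i) (hn' : l ≤ n' + i) :
    PsiAux c θ t n i κ.1 κ.2 = PsiAux c θ t n' i κ.1 κ.2 := by
  induction n generalizing n' i κ with
  | zero => have := i.2; lia
  | succ n ih =>
    cases n' with
    | zero => have := i.2; lia
    | succ n' =>
      rw [PsiAux_succ, PsiAux_succ]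
      refine sum_congr rfl fun κ' _ => congrArg _ (prod_congr rfl fun j hj => ?_)
      have := Fin.lt_def.1 (STree.lt_of_mem_child hj)
      exact ih n' j κ' (by lia) (by lia)

theorem PsiN_eq (c : SRK m s M) (θ : Mbar M → ℝ) (t : STree l m) (i : Fin l)
    (κ : SIdx m M × Fin s) :
    PsiN c θ t i κ.1 κ.2 = ∑ κ' ∈ states s (t.color i), c.Z θ κ.1 κ'.1 κ.2 κ'.2 *
      ∏ j ∈ t.child i.succ, PsiN c θ t j κ'.1 κ'.2 := by
  rw [PsiN, PsiAux_stable c θ t l (l + 1) i κ (by lia) (by lia), PsiAux_succ]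
  rfl

end Recursion

section Locality

variable {d m s l : ℕ} {M : Type}

/-- Two trees have the same colours and the same sons at the nodes of `A`, and `A` is closed
under passing to sons. -/
def AgreeOn (A : Finset (Fin l)) (t t' : STree l m) : Prop :=
  ∀ i ∈ A, t.color i = t'.color i ∧ t.child i.succ = t'.child i.succ ∧ t.child i.succ ⊆ A

variable {A : Finset (Fin l)} {t t' : STree l m}

theorem AgreeOn.sizeAux_eq (h : AgreeOn A t t') (n : ℕ) :
    ∀ i ∈ A, sizeAux t n i = sizeAux t' n i := by
  induction n with
  | zero => intro i _; rfl
  | succ n ih =>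
    intro i hi
    obtain ⟨-, h2, h3⟩ := h i hi
    rw [sizeAux, sizeAux, ← h2]
    exact congrArg _ (sum_congr rfl fun c hc => ih c (h3 hc))

theorem AgreeOn.densAux_eq (h : AgreeOn A t t') (n : ℕ) :
    ∀ i ∈ A, densAux t n i = densAux t' n i := by
  induction n with
  | zero => intro i _; rfl
  | succ n ih =>
    intro i hi
    obtain ⟨-, h2, h3⟩ := h i hi
    rw [densAux, densAux, ← h2, STree.size, STree.size, h.sizeAux_eq l i hi]
    exact congrArg _ (prod_congr rfl fun c hc => ih c (h3 hc))

theorem AgreeOn.elemFAux_eq (a : Evec d → Evec d) (b : Fin m → Evec d → Evec d)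
    (h : AgreeOn A t t') (x : Evec d) (n : ℕ) :
    ∀ i ∈ A, elemFAux a b t n i x = elemFAux a b t' n i x := by
  induction n with
  | zero => intro i _; rfl
  | succ n ih =>
    intro i hi
    obtain ⟨h1, h2, h3⟩ := h i hi
    rw [elemFAux_succ, elemFAux_succ, ← h1, ← h2]
    exact finsetFDeriv_congr _ _ fun c hc => ih c (h3 hc)

theorem AgreeOn.PsiAux_eq [Fintype M] (c : SRK m s M) (θ : Mbar M → ℝ)
    (h : AgreeOn A t t') (n : ℕ) :
    ∀ i ∈ A, ∀ κ : SIdx m M × Fin s,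
      PsiAux c θ t n i κ.1 κ.2 = PsiAux c θ t' n i κ.1 κ.2 := by
  induction n with
  | zero => intro i _ _; rfl
  | succ n ih =>
    intro i hi κ
    obtain ⟨h1, h2, h3⟩ := h i hi
    rw [PsiAux_succ, PsiAux_succ, ← h1, ← h2]
    exact sum_congr rfl fun κ' _ => congrArg _ (prod_congr rfl fun j hj => ih j (h3 hj) κ')

end Locality

section Decomposition

variable {m l : ℕ}

/-- The trees in which every node of `S` has its father in `S` or equal to the label `r`, while the
nodes outside `S` carry default data. They represent the trees on `S` with root `r`. -/
def treesOn (m : ℕ) (S : Finset (Fin l)) (r : Fin (l + 1)) : Finset (STree l m) :=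
  univ.filter fun t =>
    (∀ i ∈ S, t.father i = r ∨ ∃ j ∈ S, t.father i = j.succ) ∧
      ∀ i ∉ S, t.father i = 0 ∧ t.color i = none

theorem mem_treesOn {S : Finset (Fin l)} {r : Fin (l + 1)} {t : STree l m} :
    t ∈ treesOn m S r ↔ (∀ i ∈ S, t.father i = r ∨ ∃ j ∈ S, t.father i = j.succ) ∧
      ∀ i ∉ S, t.father i = 0 ∧ t.color i = none := by
  simp [treesOn]

/-- The sons of the label `v` that lie in `S`. -/
def STree.childIn (t : STree l m) (S : Finset (Fin l)) (v : Fin (l + 1)) : Finset (Fin l) :=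
  S.filter fun i => t.father i = v

theorem STree.mem_childIn {t : STree l m} {S : Finset (Fin l)} {v : Fin (l + 1)} {i : Fin l} :
    i ∈ t.childIn S v ↔ i ∈ S ∧ t.father i = v := by
  simp [STree.childIn]

theorem child_succ_subset {S : Finset (Fin l)} {r : Fin (l + 1)} {t : STree l m}
    (ht : t ∈ treesOn m S r) (i : Fin l) : t.child i.succ ⊆ S := by
  intro c hc
  by_contra hcS
  have := ((mem_treesOn.1 ht).2 c hcS).1
  rw [STree.mem_child.1 hc] at this
  exact Fin.succ_ne_zero i this

theorem sum_size_childIn {S : Finset (Fin l)} {r : Fin (l + 1)} {t : STree l m}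
    (ht : t ∈ treesOn m S r) (hr : ∀ i ∈ S, r ≤ i.castSucc) :
    ∑ c ∈ t.childIn S r, t.size c = S.card := by
  have hdouble : ∑ i ∈ S, ∑ c ∈ t.child i.succ, t.size c =
      ∑ c ∈ S.filter (fun c => ¬ t.father c = r), t.size c := by
    rw [← sum_biUnion]
    · refine sum_congr ?_ fun _ _ => rfl
      ext c
      simp only [mem_biUnion, STree.mem_child, mem_filter]
      constructor
      · rintro ⟨i, hi, hc⟩
        refine ⟨child_succ_subset ht i (STree.mem_child.2 hc), fun h => ?_⟩
        have := Fin.le_def.1 (hr i hi)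
        rw [← h, hc] at this
        simp at this
      · rintro ⟨hc, hne⟩
        obtain ⟨j, hj, h⟩ := ((mem_treesOn.1 ht).1 c hc).resolve_left hne
        exact ⟨j, hj, h⟩
    · intro i _ j _ hij
      refine disjoint_left.2 fun c h1 h2 => hij ?_
      exact Fin.succ_injective _ ((STree.mem_child.1 h1).symm.trans (STree.mem_child.1 h2))
  have hsum : ∑ i ∈ S, t.size i = S.card + ∑ i ∈ S, ∑ c ∈ t.child i.succ, t.size c := by
    rw [sum_congr rfl fun i _ => t.size_eq i, sum_add_distrib]
    simp
  have hsplit := sum_filter_add_sum_filter_not S (fun c => t.father c = r) t.size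
  rw [STree.childIn]
  lia

/-- The tree on `A` obtained by forgetting the other nodes. -/
def STree.restrict (t : STree l m) (A : Finset (Fin l)) : STree l m where
  father i := if i ∈ A then t.father i else 0
  color i := if i ∈ A then t.color i else none
  mono i := by
    have := t.mono i
    split_ifs <;> simp_all

/-- The tree obtained by attaching to `r` a node `i₀` of colour `rc`, with the tree `t₁` on `A`
above it, next to the tree `t₂`. -/
def graft (r : Fin (l + 1)) (i₀ : Fin l) (hr : r ≤ i₀.castSucc) (A : Finset (Fin l))
    (rc : Option (Fin m)) (t₁ t₂ : STree l m) : STree l m where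
  father i := if i = i₀ then r else if i ∈ A then t₁.father i else t₂.father i
  color i := if i = i₀ then rc else if i ∈ A then t₁.color i else t₂.color i
  mono i := by
    have h1 := t₁.mono i
    have h2 := t₂.mono i
    split_ifs with h
    · subst h; exact Fin.le_def.1 hr
    · exact h1
    · exact h2

/-- `A` consists of the proper descendants of `i₀` among the nodes in `S`. -/
def IsBranch (t : STree l m) (S : Finset (Fin l)) (i₀ : Fin l) (A : Finset (Fin l)) : Prop :=
  ∀ i ∈ S, i ∈ A ↔ t.father i = i₀.succ ∨ ∃ j ∈ A, t.father i = j.succ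

/-- The proper descendants of `i₀` along nodes of `S`. -/
inductive Descends (t : STree l m) (S : Finset (Fin l)) (i₀ : Fin l) : Fin l → Prop
  | son {i : Fin l} : i ∈ S → t.father i = i₀.succ → Descends t S i₀ i
  | step {i j : Fin l} : i ∈ S → Descends t S i₀ j → t.father i = j.succ → Descends t S i₀ i

theorem Descends.mem {t : STree l m} {S : Finset (Fin l)} {i₀ i : Fin l}
    (h : Descends t S i₀ i) : i ∈ S := by
  cases h <;> assumption

theorem existsUnique_isBranch (t : STree l m) (S : Finset (Fin l)) (i₀ : Fin l) :
    ∃! A, A ∈ S.powerset ∧ IsBranch t S i₀ A := by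
  classical
  refine ⟨S.filter (Descends t S i₀), ⟨by simp, fun i hi => ?_⟩, ?_⟩
  · rw [mem_filter]
    constructor
    · rintro ⟨-, h⟩
      cases h with
      | son _ h => exact Or.inl h
      | step _ hj h => exact Or.inr ⟨_, mem_filter.2 ⟨hj.mem, hj⟩, h⟩
    · rintro (h | ⟨j, hj, h⟩)
      · exact ⟨hi, .son hi h⟩
      · exact ⟨hi, .step hi (mem_filter.1 hj).2 h⟩
  · rintro A ⟨hAS, hA⟩
    rw [mem_powerset] at hAS
    ext i
    rw [mem_filter]
    constructor
    · intro h
      refine ⟨hAS h, ?_⟩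
      induction i using WellFoundedLT.induction with
      | ind i ih =>
        rcases (hA i (hAS h)).1 h with h' | ⟨j, hj, h'⟩
        · exact .son (hAS h) h'
        · exact .step (hAS h) (ih j (STree.lt_of_mem_child (STree.mem_child.2 h')) hj) h'
    · rintro ⟨-, h⟩
      induction h with
      | son hi h => exact (hA _ hi).2 (Or.inl h)
      | step hi _ h ih => exact (hA _ hi).2 (Or.inr ⟨_, ih, h⟩)

section Graft

variable {S A : Finset (Fin l)} {r : Fin (l + 1)} {i₀ : Fin l} {rc : Option (Fin m)}
  {t t₁ t₂ : STree l m}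

theorem father_graft_self (hr : r ≤ i₀.castSucc) :
    (graft r i₀ hr A rc t₁ t₂).father i₀ = r := by
  simp [graft]

theorem color_graft_self (hr : r ≤ i₀.castSucc) :
    (graft r i₀ hr A rc t₁ t₂).color i₀ = rc := by
  simp [graft]

theorem graft_of_mem (hr : r ≤ i₀.castSucc) (hS : ∀ i ∈ S, i₀ < i) (hA : A ⊆ S) {i : Fin l}
    (hi : i ∈ A) : (graft r i₀ hr A rc t₁ t₂).father i = t₁.father i ∧
      (graft r i₀ hr A rc t₁ t₂).color i = t₁.color i := by
  have : i ≠ i₀ := (hS i (hA hi)).ne'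
  simp [graft, hi, this]

theorem graft_of_notMem (hr : r ≤ i₀.castSucc) {i : Fin l} (hi₀ : i ≠ i₀)
    (hi : i ∉ A) : (graft r i₀ hr A rc t₁ t₂).father i = t₂.father i ∧
      (graft r i₀ hr A rc t₁ t₂).color i = t₂.color i := by
  simp [graft, hi, hi₀]

theorem ne_succ_of_le_castSucc {i : Fin l} (hr : r ≤ i₀.castSucc) (hi : i₀ ≤ i) : r ≠ i.succ := by
  rintro rfl
  have h1 := Fin.le_def.1 hr
  have h2 := Fin.le_def.1 hi
  simp at h1
  lia

theorem father_ne_of_mem_treesOn_sdiff (hr : r ≤ i₀.castSucc) (hS : ∀ i ∈ S, i₀ < i)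
    (ht₂ : t₂ ∈ treesOn m (S \ A) r) {i : Fin l} (hi : i ∈ S \ A) :
    t₂.father i ≠ i₀.succ ∧ ∀ j ∈ A, j ∈ S → t₂.father i ≠ j.succ := by
  rcases (mem_treesOn.1 ht₂).1 i hi with h | ⟨j, hj, h⟩
  · rw [h]
    exact ⟨ne_succ_of_le_castSucc hr le_rfl, fun j _ hj => ne_succ_of_le_castSucc hr (hS j hj).le⟩
  · rw [h]
    obtain ⟨hjS, hjA⟩ := mem_sdiff.1 hj
    refine ⟨fun h' => (hS j hjS).ne' (Fin.succ_injective _ h'), fun k hk _ h' => hjA ?_⟩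
    rwa [Fin.succ_injective _ h']

theorem father_ne_root (hr : r ≤ i₀.castSucc) (hS : ∀ i ∈ S, i₀ < i) (hA : A ⊆ S)
    (ht₁ : t₁ ∈ treesOn m A i₀.succ) {i : Fin l} (hi : i ∈ A) : t₁.father i ≠ r := by
  rcases (mem_treesOn.1 ht₁).1 i hi with h | ⟨j, hj, h⟩
  · rw [h]
    exact (ne_succ_of_le_castSucc hr le_rfl).symm
  · rw [h]
    exact (ne_succ_of_le_castSucc hr (hS j (hA hj)).le).symm

theorem graft_mem_treesOn (hr : r ≤ i₀.castSucc) (hS : ∀ i ∈ S, i₀ < i) (hA : A ⊆ S)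
    (ht₁ : t₁ ∈ treesOn m A i₀.succ) (ht₂ : t₂ ∈ treesOn m (S \ A) r) :
    graft r i₀ hr A rc t₁ t₂ ∈ treesOn m (insert i₀ S) r := by
  rw [mem_treesOn]
  constructor
  · intro i hi
    rcases eq_or_ne i i₀ with rfl | hi₀
    · exact Or.inl (father_graft_self hr)
    · have hiS := mem_of_mem_insert_of_ne hi hi₀
      by_cases hiA : i ∈ A
      · rw [(graft_of_mem hr hS hA hiA).1]
        rcases (mem_treesOn.1 ht₁).1 i hiA with h | ⟨j, hj, h⟩
        · exact Or.inr ⟨i₀, mem_insert_self _ _, h⟩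
        · exact Or.inr ⟨j, mem_insert_of_mem (hA hj), h⟩
      · rw [(graft_of_notMem hr hi₀ hiA).1]
        rcases (mem_treesOn.1 ht₂).1 i (mem_sdiff.2 ⟨hiS, hiA⟩) with h | ⟨j, hj, h⟩
        · exact Or.inl h
        · exact Or.inr ⟨j, mem_insert_of_mem (mem_sdiff.1 hj).1, h⟩
  · intro i hi
    rw [mem_insert, not_or] at hi
    have hiA : i ∉ A := fun h => hi.2 (hA h)
    rw [(graft_of_notMem hr hi.1 hiA).1, (graft_of_notMem hr hi.1 hiA).2]
    exact (mem_treesOn.1 ht₂).2 i fun h => hi.2 (mem_sdiff.1 h).1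

theorem isBranch_graft (hr : r ≤ i₀.castSucc) (hS : ∀ i ∈ S, i₀ < i) (hA : A ⊆ S)
    (ht₁ : t₁ ∈ treesOn m A i₀.succ) (ht₂ : t₂ ∈ treesOn m (S \ A) r) :
    IsBranch (graft r i₀ hr A rc t₁ t₂) S i₀ A := by
  intro i hi
  by_cases hiA : i ∈ A
  · rw [(graft_of_mem hr hS hA hiA).1]
    exact iff_of_true hiA ((mem_treesOn.1 ht₁).1 i hiA)
  · rw [(graft_of_notMem hr (hS i hi).ne' hiA).1]
    obtain ⟨h1, h2⟩ := father_ne_of_mem_treesOn_sdiff hr hS ht₂ (mem_sdiff.2 ⟨hi, hiA⟩)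
    refine iff_of_false hiA ?_
    rintro (h | ⟨j, hj, h⟩)
    · exact h1 h
    · exact h2 j hj (hA hj) h

theorem father_eq_root (hr : r ≤ i₀.castSucc) (hS : ∀ i ∈ S, i₀ < i)
    (ht : t ∈ treesOn m (insert i₀ S) r) : t.father i₀ = r := by
  refine ((mem_treesOn.1 ht).1 i₀ (mem_insert_self _ _)).resolve_right ?_
  rintro ⟨j, hj, h⟩
  have hlt := STree.lt_of_mem_child (STree.mem_child.2 h)
  rcases mem_insert.1 hj with rfl | hj
  · exact hlt.ne rfl
  · exact hlt.asymm (hS j hj)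

theorem restrict_mem_treesOn (hA : A ⊆ S) (h : IsBranch t S i₀ A) :
    t.restrict A ∈ treesOn m A i₀.succ := by
  rw [mem_treesOn]
  constructor
  · intro i hi
    simpa [STree.restrict, hi] using (h i (hA hi)).1 hi
  · intro i hi
    simp [STree.restrict, hi]

theorem restrict_sdiff_mem_treesOn (h : IsBranch t S i₀ A)
    (ht : t ∈ treesOn m (insert i₀ S) r) : t.restrict (S \ A) ∈ treesOn m (S \ A) r := by
  rw [mem_treesOn]
  constructor
  · intro i hi
    obtain ⟨hiS, hiA⟩ := mem_sdiff.1 hi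
    have hfather : (t.restrict (S \ A)).father i = t.father i := if_pos hi
    rw [hfather]
    have hnot := mt (h i hiS).2 hiA
    refine ((mem_treesOn.1 ht).1 i (mem_insert_of_mem hiS)).imp_right ?_
    rintro ⟨j, hj, hij⟩
    refine ⟨j, mem_sdiff.2 ⟨?_, fun hjA => hnot (Or.inr ⟨j, hjA, hij⟩)⟩, hij⟩
    refine mem_of_mem_insert_of_ne hj ?_
    rintro rfl
    exact hnot (Or.inl hij)
  · intro i hi
    exact ⟨if_neg hi, if_neg hi⟩

theorem graft_restrict (hr : r ≤ i₀.castSucc) (hS : ∀ i ∈ S, i₀ < i)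
    (ht : t ∈ treesOn m (insert i₀ S) r) :
    graft r i₀ hr A (t.color i₀) (t.restrict A) (t.restrict (S \ A)) = t := by
  have hroot := father_eq_root hr hS ht
  have hout := (mem_treesOn.1 ht).2
  ext i : 2 <;> simp only [graft, STree.restrict, mem_sdiff, mem_insert, not_or] at hout ⊢ <;>
    split_ifs with h1 h2 h3
  all_goals first
    | rfl
    | simp_all

theorem restrict_graft (hr : r ≤ i₀.castSucc) (hS : ∀ i ∈ S, i₀ < i) (hA : A ⊆ S)
    (ht₁ : t₁ ∈ treesOn m A i₀.succ) : (graft r i₀ hr A rc t₁ t₂).restrict A = t₁ := by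
  have hout := (mem_treesOn.1 ht₁).2
  ext i : 2 <;> by_cases hi : i ∈ A
  · exact (if_pos hi).trans (graft_of_mem hr hS hA hi).1
  · exact (if_neg hi).trans (hout i hi).1.symm
  · exact (if_pos hi).trans (graft_of_mem hr hS hA hi).2
  · exact (if_neg hi).trans (hout i hi).2.symm

theorem restrict_sdiff_graft (hr : r ≤ i₀.castSucc) (hS : ∀ i ∈ S, i₀ < i)
    (ht₂ : t₂ ∈ treesOn m (S \ A) r) : (graft r i₀ hr A rc t₁ t₂).restrict (S \ A) = t₂ := by
  have hout := (mem_treesOn.1 ht₂).2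
  ext i : 2 <;> by_cases hi : i ∈ S \ A
  · exact (if_pos hi).trans
      (graft_of_notMem hr (hS i (mem_sdiff.1 hi).1).ne' (mem_sdiff.1 hi).2).1
  · exact (if_neg hi).trans (hout i hi).1.symm
  · exact (if_pos hi).trans
      (graft_of_notMem hr (hS i (mem_sdiff.1 hi).1).ne' (mem_sdiff.1 hi).2).2
  · exact (if_neg hi).trans (hout i hi).2.symm

end Graft

/-- Summing over the trees on `insert i₀ S`, where `i₀` is the smallest node, amounts to choosing
the set `A` of descendants of `i₀`, a colour for `i₀`, a tree on `A` and a tree on `S \ A`. -/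
theorem sum_treesOn_insert {V : Type} [AddCommMonoid V] (S : Finset (Fin l)) (r : Fin (l + 1))
    (i₀ : Fin l) (hr : r ≤ i₀.castSucc) (hS : ∀ i ∈ S, i₀ < i) (W : STree l m → V) :
    ∑ t ∈ treesOn m (insert i₀ S) r, W t =
      ∑ A ∈ S.powerset, ∑ rc : Option (Fin m), ∑ t₁ ∈ treesOn m A i₀.succ,
        ∑ t₂ ∈ treesOn m (S \ A) r, W (graft r i₀ hr A rc t₁ t₂) := by
  classical
  have hunique : ∀ t : STree l m, W t = ∑ A ∈ S.powerset, if IsBranch t S i₀ A then W t else 0 := by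
    intro t
    obtain ⟨A, ⟨hA, hbranch⟩, huniq⟩ := existsUnique_isBranch t S i₀
    rw [sum_eq_single_of_mem A hA, if_pos hbranch]
    intro A' hA' hne
    exact if_neg fun h => hne (huniq A' ⟨hA', h⟩)
  rw [sum_congr rfl fun t _ => hunique t, sum_comm]
  refine sum_congr rfl fun A hA => ?_
  rw [mem_powerset] at hA
  rw [← sum_filter]
  simp_rw [← sum_product']
  refine sum_nbij' (fun t => (t.color i₀, t.restrict A, t.restrict (S \ A)))
    (fun x => graft r i₀ hr A x.1 x.2.1 x.2.2) ?_ ?_ ?_ ?_ ?_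
  · intro t ht
    obtain ⟨ht, hbranch⟩ := mem_filter.1 ht
    simp only [mem_product, mem_univ, true_and]
    exact ⟨restrict_mem_treesOn hA hbranch, restrict_sdiff_mem_treesOn hbranch ht⟩
  · rintro ⟨rc, t₁, t₂⟩ hx
    simp only [mem_product, mem_univ, true_and] at hx
    exact mem_filter.2 ⟨graft_mem_treesOn hr hS hA hx.1 hx.2, isBranch_graft hr hS hA hx.1 hx.2⟩
  · intro t ht
    exact graft_restrict hr hS (mem_filter.1 ht).1
  · rintro ⟨rc, t₁, t₂⟩ hx
    simp only [mem_product, mem_univ, true_and] at hx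
    simp only [color_graft_self, restrict_graft hr hS hA hx.1, restrict_sdiff_graft hr hS hx.2]
  · intro t ht
    rw [graft_restrict hr hS (mem_filter.1 ht).1]

end Decomposition

section GraftWeights

variable {d m s l : ℕ} {M : Type} {S A : Finset (Fin l)} {r : Fin (l + 1)} {i₀ : Fin l}
  {rc : Option (Fin m)} {t t₁ t₂ : STree l m}

theorem childIn_graft (hr : r ≤ i₀.castSucc) (hS : ∀ i ∈ S, i₀ < i) (hA : A ⊆ S)
    (ht₁ : t₁ ∈ treesOn m A i₀.succ) :
    (graft r i₀ hr A rc t₁ t₂).childIn (insert i₀ S) r = insert i₀ (t₂.childIn (S \ A) r) := by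
  ext i
  simp only [STree.mem_childIn, mem_insert, mem_sdiff]
  rcases eq_or_ne i i₀ with rfl | hi₀
  · simp [father_graft_self]
  · by_cases hiA : i ∈ A
    · rw [(graft_of_mem hr hS hA hiA).1]
      simp [hi₀, hiA, father_ne_root hr hS hA ht₁ hiA]
    · rw [(graft_of_notMem hr hi₀ hiA).1]
      simp [hi₀, hiA]

theorem child_succ_graft (hr : r ≤ i₀.castSucc) (hS : ∀ i ∈ S, i₀ < i) (hA : A ⊆ S)
    (ht₁ : t₁ ∈ treesOn m A i₀.succ) (ht₂ : t₂ ∈ treesOn m (S \ A) r) {i : Fin l}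
    (hi : i = i₀ ∨ i ∈ A) : (graft r i₀ hr A rc t₁ t₂).child i.succ = t₁.child i.succ := by
  have hle : i₀ ≤ i := hi.elim (fun h => h.ge) fun h => (hS i (hA h)).le
  ext k
  rw [STree.mem_child, STree.mem_child]
  by_cases hkA : k ∈ A
  · rw [(graft_of_mem hr hS hA hkA).1]
  · rw [((mem_treesOn.1 ht₁).2 k hkA).1]
    refine iff_of_false ?_ (Fin.succ_ne_zero i).symm
    rcases eq_or_ne k i₀ with rfl | hk₀
    · rw [father_graft_self]
      exact ne_succ_of_le_castSucc hr hle
    · rw [(graft_of_notMem hr hk₀ hkA).1]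
      by_cases hk : k ∈ S \ A
      · obtain ⟨h1, h2⟩ := father_ne_of_mem_treesOn_sdiff hr hS ht₂ hk
        rcases hi with rfl | hi
        · exact h1
        · exact h2 i hi (hA hi)
      · rw [((mem_treesOn.1 ht₂).2 k hk).1]
        exact (Fin.succ_ne_zero i).symm

theorem agreeOn_graft_left (hr : r ≤ i₀.castSucc) (hS : ∀ i ∈ S, i₀ < i) (hA : A ⊆ S)
    (ht₁ : t₁ ∈ treesOn m A i₀.succ) (ht₂ : t₂ ∈ treesOn m (S \ A) r) :
    AgreeOn A (graft r i₀ hr A rc t₁ t₂) t₁ := by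
  intro i hi
  have hchild := child_succ_graft (rc := rc) hr hS hA ht₁ ht₂ (Or.inr hi)
  exact ⟨(graft_of_mem hr hS hA hi).2, hchild, hchild ▸ child_succ_subset ht₁ i⟩

theorem agreeOn_graft_right (hr : r ≤ i₀.castSucc) (hS : ∀ i ∈ S, i₀ < i) (hA : A ⊆ S)
    (ht₁ : t₁ ∈ treesOn m A i₀.succ) (ht₂ : t₂ ∈ treesOn m (S \ A) r) :
    AgreeOn (S \ A) (graft r i₀ hr A rc t₁ t₂) t₂ := by
  intro i hi
  obtain ⟨hiS, hiA⟩ := mem_sdiff.1 hi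
  have hchild : (graft r i₀ hr A rc t₁ t₂).child i.succ = t₂.child i.succ := by
    ext k
    rw [STree.mem_child, STree.mem_child]
    by_cases hk : k = i₀ ∨ k ∈ A
    · have hk₂ : k ∉ S \ A := by
        rw [mem_sdiff]
        rcases hk with rfl | hk
        · exact fun h => (hS k h.1).ne rfl
        · exact fun h => h.2 hk
      rw [((mem_treesOn.1 ht₂).2 k hk₂).1]
      refine iff_of_false ?_ (Fin.succ_ne_zero i).symm
      rcases hk with rfl | hk
      · rw [father_graft_self]
        exact ne_succ_of_le_castSucc hr (hS i hiS).le
      · rw [(graft_of_mem hr hS hA hk).1]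
        rcases (mem_treesOn.1 ht₁).1 k hk with h | ⟨j, hj, h⟩ <;> rw [h] <;> intro h'
        · exact (hS i hiS).ne (Fin.succ_injective _ h')
        · exact hiA (Fin.succ_injective _ h' ▸ hj)
    · rw [not_or] at hk
      rw [(graft_of_notMem hr hk.1 hk.2).1]
  exact ⟨(graft_of_notMem hr (hS i hiS).ne' hiA).2, hchild, hchild ▸ child_succ_subset ht₂ i⟩

theorem child_succ_eq_childIn (ht : t ∈ treesOn m S r) (i : Fin l) :
    t.child i.succ = t.childIn S i.succ := by
  ext k
  rw [STree.mem_child, STree.mem_childIn]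
  exact ⟨fun h => ⟨child_succ_subset ht i (STree.mem_child.2 h), h⟩, fun h => h.2⟩

theorem child_self_graft (hr : r ≤ i₀.castSucc) (hS : ∀ i ∈ S, i₀ < i) (hA : A ⊆ S)
    (ht₁ : t₁ ∈ treesOn m A i₀.succ) (ht₂ : t₂ ∈ treesOn m (S \ A) r) :
    (graft r i₀ hr A rc t₁ t₂).child i₀.succ = t₁.childIn A i₀.succ :=
  (child_succ_graft hr hS hA ht₁ ht₂ (Or.inl rfl)).trans (child_succ_eq_childIn ht₁ i₀)

theorem densNode_graft_self (hr : r ≤ i₀.castSucc) (hS : ∀ i ∈ S, i₀ < i) (hA : A ⊆ S)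
    (ht₁ : t₁ ∈ treesOn m A i₀.succ) (ht₂ : t₂ ∈ treesOn m (S \ A) r) :
    (graft r i₀ hr A rc t₁ t₂).densNode i₀ =
      (A.card + 1) * ∏ j ∈ t₁.childIn A i₀.succ, t₁.densNode j := by
  have hagree := agreeOn_graft_left (rc := rc) hr hS hA ht₁ ht₂
  have hmem : ∀ j ∈ t₁.childIn A i₀.succ, j ∈ A := fun j hj => (STree.mem_childIn.1 hj).1
  have hdens : ∀ j ∈ t₁.childIn A i₀.succ,
      (graft r i₀ hr A rc t₁ t₂).densNode j = t₁.densNode j :=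
    fun j hj => hagree.densAux_eq l j (hmem j hj)
  have hsize : ∀ j ∈ t₁.childIn A i₀.succ, (graft r i₀ hr A rc t₁ t₂).size j = t₁.size j :=
    fun j hj => hagree.sizeAux_eq l j (hmem j hj)
  rw [STree.densNode_eq, STree.size_eq, child_self_graft hr hS hA ht₁ ht₂, prod_congr rfl hdens,
    sum_congr rfl hsize,
    sum_size_childIn ht₁ fun i hi => Fin.le_def.2 (Fin.lt_def.1 (hS i (hA hi))), add_comm]

theorem elemF_graft_self (a : Evec d → Evec d) (b : Fin m → Evec d → Evec d) (x : Evec d)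
    (hr : r ≤ i₀.castSucc) (hS : ∀ i ∈ S, i₀ < i) (hA : A ⊆ S)
    (ht₁ : t₁ ∈ treesOn m A i₀.succ) (ht₂ : t₂ ∈ treesOn m (S \ A) r) :
    elemF a b (graft r i₀ hr A rc t₁ t₂) i₀ x =
      finsetFDeriv (nodeFun a b rc) x (t₁.childIn A i₀.succ) fun j => elemF a b t₁ j x := by
  rw [elemF_eq, child_self_graft hr hS hA ht₁ ht₂, color_graft_self]
  exact finsetFDeriv_congr _ _ fun j hj => (agreeOn_graft_left hr hS hA ht₁ ht₂).elemFAux_eq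
    a b x l j (STree.mem_childIn.1 hj).1

variable [Fintype M]

theorem PsiN_graft_self (c : SRK m s M) (θ : Mbar M → ℝ) (κ : SIdx m M × Fin s)
    (hr : r ≤ i₀.castSucc) (hS : ∀ i ∈ S, i₀ < i) (hA : A ⊆ S)
    (ht₁ : t₁ ∈ treesOn m A i₀.succ) (ht₂ : t₂ ∈ treesOn m (S \ A) r) :
    PsiN c θ (graft r i₀ hr A rc t₁ t₂) i₀ κ.1 κ.2 =
      ∑ κ' ∈ states s rc, c.Z θ κ.1 κ'.1 κ.2 κ'.2 *
        ∏ j ∈ t₁.childIn A i₀.succ, PsiN c θ t₁ j κ'.1 κ'.2 := by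
  rw [PsiN_eq, child_self_graft hr hS hA ht₁ ht₂, color_graft_self]
  exact sum_congr rfl fun κ₁ _ => congrArg _ (prod_congr rfl fun j hj =>
    (agreeOn_graft_left hr hS hA ht₁ ht₂).PsiAux_eq c θ l j (STree.mem_childIn.1 hj).1 κ₁)

/-- The product over the sons of `r` in `S` of their densities and elementary weights. -/
def treeWeight (c : SRK m s M) (θ : Mbar M → ℝ) (t : STree l m) (S : Finset (Fin l))
    (r : Fin (l + 1)) (κ : SIdx m M × Fin s) : ℝ :=
  ∏ j ∈ t.childIn S r, ((t.densNode j : ℝ) * PsiN c θ t j κ.1 κ.2)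

theorem densNode_mul_PsiN_graft_self (c : SRK m s M) (θ : Mbar M → ℝ) (κ : SIdx m M × Fin s)
    (hr : r ≤ i₀.castSucc) (hS : ∀ i ∈ S, i₀ < i) (hA : A ⊆ S)
    (ht₁ : t₁ ∈ treesOn m A i₀.succ) (ht₂ : t₂ ∈ treesOn m (S \ A) r) :
    ((graft r i₀ hr A rc t₁ t₂).densNode i₀ : ℝ) *
        PsiN c θ (graft r i₀ hr A rc t₁ t₂) i₀ κ.1 κ.2 =
      ((A.card + 1 : ℕ) : ℝ) * ∑ κ' ∈ states s rc, c.Z θ κ.1 κ'.1 κ.2 κ'.2 *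
        treeWeight c θ t₁ A i₀.succ κ' := by
  rw [densNode_graft_self hr hS hA ht₁ ht₂, PsiN_graft_self c θ κ hr hS hA ht₁ ht₂]
  simp only [treeWeight, prod_mul_distrib]
  push_cast
  rw [mul_assoc, mul_sum]
  congr 1
  exact sum_congr rfl fun κ' _ => by ring

theorem treeWeight_graft (c : SRK m s M) (θ : Mbar M → ℝ) (κ : SIdx m M × Fin s)
    (hr : r ≤ i₀.castSucc) (hS : ∀ i ∈ S, i₀ < i) (hA : A ⊆ S)
    (ht₁ : t₁ ∈ treesOn m A i₀.succ) (ht₂ : t₂ ∈ treesOn m (S \ A) r) :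
    treeWeight c θ (graft r i₀ hr A rc t₁ t₂) (insert i₀ S) r κ =
      (((A.card + 1 : ℕ) : ℝ) * ∑ κ' ∈ states s rc, c.Z θ κ.1 κ'.1 κ.2 κ'.2 *
        treeWeight c θ t₁ A i₀.succ κ') * treeWeight c θ t₂ (S \ A) r κ := by
  have hmem : ∀ j ∈ t₂.childIn (S \ A) r, j ∈ S \ A := fun j hj => (STree.mem_childIn.1 hj).1
  have hagree := agreeOn_graft_right (rc := rc) hr hS hA ht₁ ht₂
  rw [treeWeight, childIn_graft hr hS hA ht₁, prod_insert
    fun h => (hS i₀ (mem_sdiff.1 (hmem _ h)).1).ne rfl,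
    densNode_mul_PsiN_graft_self c θ κ hr hS hA ht₁ ht₂]
  congr 1
  refine prod_congr rfl fun j hj => ?_
  rw [STree.densNode, PsiN, hagree.densAux_eq l j (hmem j hj), hagree.PsiAux_eq c θ l j (hmem j hj)]
  rfl

variable {F : Type} [NormedAddCommGroup F] [NormedSpace ℝ F]

/-- The contribution of a tree on `S` with root `r` to the derivatives of a composition with `g`. -/
def treeTerm (c : SRK m s M) (θ : Mbar M → ℝ) (a : Evec d → Evec d) (b : Fin m → Evec d → Evec d)
    (y0 : Evec d) (g : Evec d → F) (t : STree l m) (S : Finset (Fin l)) (r : Fin (l + 1))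
    (κ : SIdx m M × Fin s) : F :=
  treeWeight c θ t S r κ • finsetFDeriv g y0 (t.childIn S r) fun j => elemF a b t j y0

theorem treeTerm_graft (c : SRK m s M) (θ : Mbar M → ℝ) (a : Evec d → Evec d)
    (b : Fin m → Evec d → Evec d) (y0 : Evec d) {g : Evec d → F}
    (hg : ContDiff ℝ (S.card + 1 : ℕ) g) (κ : SIdx m M × Fin s)
    (hr : r ≤ i₀.castSucc) (hS : ∀ i ∈ S, i₀ < i) (hA : A ⊆ S)
    (ht₁ : t₁ ∈ treesOn m A i₀.succ) (ht₂ : t₂ ∈ treesOn m (S \ A) r) :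
    treeTerm c θ a b y0 g (graft r i₀ hr A rc t₁ t₂) (insert i₀ S) r κ =
      treeTerm c θ a b y0 (fderiv ℝ g) t₂ (S \ A) r κ
        (((A.card + 1 : ℕ) : ℝ) • ∑ κ' ∈ states s rc, c.Z θ κ.1 κ'.1 κ.2 κ'.2 •
          treeTerm c θ a b y0 (nodeFun a b rc) t₁ A i₀.succ κ') := by
  have hmem : ∀ j ∈ t₂.childIn (S \ A) r, j ∈ S \ A := fun j hj => (STree.mem_childIn.1 hj).1
  have hcard : (t₂.childIn (S \ A) r).card ≤ S.card :=
    card_le_card fun j hj => (mem_sdiff.1 (hmem j hj)).1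
  have helemF : ∀ j ∈ t₂.childIn (S \ A) r,
      elemF a b (graft r i₀ hr A rc t₁ t₂) j y0 = elemF a b t₂ j y0 := fun j hj =>
    (agreeOn_graft_right hr hS hA ht₁ ht₂).elemFAux_eq a b y0 l j (hmem j hj)
  rw [treeTerm, treeWeight_graft c θ κ hr hS hA ht₁ ht₂, childIn_graft hr hS hA ht₁,
    finsetFDeriv_insert y0 (hg.of_le (by norm_cast; lia))
      fun j hj => hS j (mem_sdiff.1 (hmem j hj)).1,
    elemF_graft_self a b y0 hr hS hA ht₁ ht₂,
    finsetFDeriv_congr _ _ helemF]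
  simp only [treeTerm, smul_smul, ← sum_smul, _root_.smul_apply, map_smul]

theorem sum_treeTerm_empty (c : SRK m s M) (θ : Mbar M → ℝ) (a : Evec d → Evec d)
    (b : Fin m → Evec d → Evec d) (y0 : Evec d) (g : Evec d → F) (r : Fin (l + 1))
    (κ : SIdx m M × Fin s) :
    ∑ t ∈ treesOn m (∅ : Finset (Fin l)) r, treeTerm c θ a b y0 g t ∅ r κ = g y0 := by
  have hsingle : treesOn m (∅ : Finset (Fin l)) r = {⟨fun _ => 0, fun _ => none, by simp⟩} := by
    ext t
    rw [mem_treesOn, mem_singleton]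
    constructor
    · rintro ⟨-, h⟩
      ext i : 2
      · exact (h i (notMem_empty i)).1
      · exact (h i (notMem_empty i)).2
    · rintro rfl
      simp
  rw [hsingle, sum_singleton, treeTerm, treeWeight]
  simp [STree.childIn, finsetFDeriv_empty]

/-- The derivatives of a composition `g ∘ h κ` are sums over rooted trees as soon as the
derivatives of the curves `h κ` satisfy the recursion coming from the stage equations. -/
theorem iteratedDeriv_comp_eq_sum_treeTerm (c : SRK m s M) (θ : Mbar M → ℝ)
    (a : Evec d → Evec d) (b : Fin m → Evec d → Evec d) (y0 : Evec d) (N : ℕ)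
    (hab : ∀ rc, ContDiff ℝ N (nodeFun a b rc))
    (h : SIdx m M × Fin s → ℝ → Evec d) (hh : ∀ κ, ContDiffAt ℝ N (h κ) 0) (h0 : ∀ κ, h κ 0 = y0)
    (hrec : ∀ n, n + 1 ≤ N → ∀ κ, iteratedDeriv (n + 1) (h κ) 0 =
      ((n + 1 : ℕ) : ℝ) • ∑ rc, ∑ κ' ∈ states s rc, c.Z θ κ.1 κ'.1 κ.2 κ'.2 •
        iteratedDeriv n (fun u => nodeFun a b rc (h κ' u)) 0) (n : ℕ) :
    ∀ {F : Type} [NormedAddCommGroup F] [NormedSpace ℝ F] {S : Finset (Fin l)} {r : Fin (l + 1)}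
      {g : Evec d → F}, S.card = n → n ≤ N → (∀ i ∈ S, r ≤ i.castSucc) → ContDiff ℝ n g →
      ∀ κ, iteratedDeriv n (fun u => g (h κ u)) 0 =
        ∑ t ∈ treesOn m S r, treeTerm c θ a b y0 g t S r κ := by
  induction n using Nat.strong_induction_on with
  | _ n ih =>
  intro F _ _ S r g hcard hn hr hg κ
  cases n with
  | zero =>
    obtain rfl := card_eq_zero.1 hcard
    rw [sum_treeTerm_empty, iteratedDeriv_zero, h0]
  | succ n =>
    obtain ⟨i₀, S', hS, hrfl, hcard'⟩ : ∃ i₀ S', (∀ i ∈ S', i₀ < i) ∧ S = insert i₀ S' ∧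
        S'.card = n := by
      have hne : S.Nonempty := card_pos.1 (by lia)
      refine ⟨S.min' hne, S.erase (S.min' hne), fun i hi => min'_lt_of_mem_erase_min' S hne hi,
        (insert_erase (min'_mem S hne)).symm, ?_⟩
      rw [card_erase_of_mem (min'_mem S hne), hcard, Nat.add_sub_cancel]
    subst hrfl
    have hr₀ : r ≤ i₀.castSucc := hr i₀ (mem_insert_self _ _)
    have hκ : ContDiffAt ℝ (n + 1 : ℕ) (h κ) 0 := (hh κ).of_le (by norm_cast)
    have hκ' : ContDiffAt ℝ n (h κ) 0 := hκ.of_le (by norm_cast; lia)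
    have hg' : ContDiff ℝ n (fderiv ℝ g) := hg.fderiv_right (by norm_cast)
    have hderiv : deriv (fun u => g (h κ u)) =ᶠ[nhds 0]
        fun u => fderiv ℝ g (h κ u) (deriv (h κ) u) := by
      filter_upwards [eventually_differentiableAt hκ] with u hu
      exact ((hg.differentiable (by simp) _).hasFDerivAt.comp_hasDerivAt u hu.hasDerivAt).deriv
    rw [iteratedDeriv_succ', hderiv.iteratedDeriv_eq, ← hcard',
      iteratedDeriv_clm_apply_eq_sum_powerset S'
        (hcard' ▸ hg'.contDiffAt.comp (0 : ℝ) hκ') (hcard' ▸ contDiffAt_deriv hκ),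
      sum_treesOn_insert S' r i₀ hr₀ hS]
    refine sum_congr rfl fun A hA => ?_
    rw [mem_powerset] at hA
    have hAcard : A.card ≤ n := hcard' ▸ card_le_card hA
    have hBcard : (S' \ A).card ≤ n := hcard' ▸ card_le_card sdiff_subset
    rw [ih _ (by lia) rfl (by lia) (fun i hi => hr i (mem_insert_of_mem (mem_sdiff.1 hi).1))
      (hg'.of_le (by exact_mod_cast hBcard)) κ, ← iteratedDeriv_succ', hrec _ (by lia)]
    have hinner : ∀ rc, ∀ κ' ∈ states s rc, c.Z θ κ.1 κ'.1 κ.2 κ'.2 •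
        iteratedDeriv A.card (fun u => nodeFun a b rc (h κ' u)) 0 =
        c.Z θ κ.1 κ'.1 κ.2 κ'.2 • ∑ t₁ ∈ treesOn m A i₀.succ,
          treeTerm c θ a b y0 (nodeFun a b rc) t₁ A i₀.succ κ' := by
      intro rc κ' _
      rw [ih _ (by lia) (r := i₀.succ) rfl (by lia)
        (fun i hi => Fin.le_def.2 (Fin.lt_def.1 (hS i (hA hi))))
        ((hab rc).of_le (by norm_cast; lia)) κ']
    have hgraft : ∀ rc, ∀ t₁ ∈ treesOn m A i₀.succ, ∑ t₂ ∈ treesOn m (S' \ A) r,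
        treeTerm c θ a b y0 g (graft r i₀ hr₀ A rc t₁ t₂) (insert i₀ S') r κ =
        (∑ t₂ ∈ treesOn m (S' \ A) r, treeTerm c θ a b y0 (fderiv ℝ g) t₂ (S' \ A) r κ)
          (((A.card + 1 : ℕ) : ℝ) • ∑ κ' ∈ states s rc, c.Z θ κ.1 κ'.1 κ.2 κ'.2 •
            treeTerm c θ a b y0 (nodeFun a b rc) t₁ A i₀.succ κ') := by
      intro rc t₁ ht₁
      rw [_root_.sum_apply]
      exact sum_congr rfl fun t₂ ht₂ =>
        treeTerm_graft c θ a b y0 (hcard' ▸ hg) κ hr₀ hS hA ht₁ ht₂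
    rw [sum_congr rfl fun rc _ => sum_congr rfl (hgraft rc),
      sum_congr rfl fun rc _ => sum_congr rfl (hinner rc)]
    simp only [← map_sum, ← smul_sum]
    congr 2
    refine sum_congr rfl fun rc _ => ?_
    simp only [smul_sum]
    exact sum_comm

end GraftWeights

section Directional

variable {ι F : Type} [Fintype ι] [DecidableEq ι] [NormedAddCommGroup F] [NormedSpace ℝ F]

theorem Dq_eq_iteratedFDeriv (n : ℕ) (Δ : ι → ℝ) (g : (ι → ℝ) → F) (x : ι → ℝ) :
    Dq n Δ g x = iteratedFDeriv ℝ n g x fun _ => Δ := by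
  have hΔ : Δ = ∑ ν, Δ ν • (Pi.single ν 1 : ι → ℝ) := by
    ext ν
    simp [Finset.sum_apply, Pi.single_apply]
  conv_rhs => rw [hΔ, ContinuousMultilinearMap.map_sum]
  exact sum_congr rfl fun νs _ => (ContinuousMultilinearMap.map_smul_univ _ _ _).symm

theorem Dq_zero_eq_iteratedDeriv {n : ℕ} (Δ : ι → ℝ) {g : (ι → ℝ) → F} {U : Set (ι → ℝ)}
    (hU : IsOpen U) (h0 : (0 : ι → ℝ) ∈ U) (hg : ContDiffOn ℝ n g U) :
    Dq n Δ g 0 = iteratedDeriv n (fun u : ℝ => g (u • Δ)) 0 := by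
  let L : ℝ →L[ℝ] (ι → ℝ) := ContinuousLinearMap.toSpanSingleton ℝ Δ
  have hL0 : L 0 = 0 := map_zero L
  have hLU : IsOpen (L ⁻¹' U) := hU.preimage L.continuous
  have h0L : (0 : ℝ) ∈ L ⁻¹' U := by rwa [Set.mem_preimage, hL0]
  have hcomp := L.iteratedFDerivWithin_comp_right hg hU.uniqueDiffOn hLU.uniqueDiffOn h0L le_rfl
  rw [iteratedFDerivWithin_of_isOpen n hLU h0L, iteratedFDerivWithin_of_isOpen n hU h0L, hL0]
    at hcomp
  rw [Dq_eq_iteratedFDeriv, iteratedDeriv]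
  change _ = iteratedFDeriv ℝ n (g ∘ L) 0 _
  rw [hcomp, ContinuousMultilinearMap.compContinuousLinearMap_apply]
  simp [L]

theorem iteratedDeriv_coord {d n : ℕ} {f : ℝ → Evec d} {x : ℝ} (hf : ContDiffAt ℝ n f x)
    (J : Fin d) : iteratedDeriv n (fun u => f u J) x = iteratedDeriv n f x J := by
  have h := (EuclideanSpace.proj (𝕜 := ℝ) J).iteratedFDeriv_comp_left hf le_rfl
  rw [iteratedDeriv, iteratedDeriv]
  exact congrArg (fun T => T fun _ => 1) h

end Directional

section Stages

variable {d m s : ℕ} {M : Type} [Fintype M]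

theorem SRK.Z_smul (c : SRK m s M) (u : ℝ) (θ : Mbar M → ℝ) (p p' : SIdx m M) (i j : Fin s) :
    c.Z (u • θ) p p' i j = u * c.Z θ p p' i j := by
  cases p' with
  | det => simp [SRK.Z]; ring
  | sto r μ =>
    simp only [SRK.Z, Pi.smul_apply, smul_eq_mul, mul_sum]
    exact sum_congr rfl fun _ _ => by ring

theorem SRK.z_smul (c : SRK m s M) (u : ℝ) (θ : Mbar M → ℝ) (p : SIdx m M) (i : Fin s) :
    c.z (u • θ) p i = u * c.z θ p i := by
  cases p with
  | det => simp [SRK.z]; ring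
  | sto r μ =>
    simp only [SRK.z, Pi.smul_apply, smul_eq_mul, mul_sum]
    exact sum_congr rfl fun _ _ => by ring

theorem sum_states_eq (a : Evec d → Evec d) (b : Fin m → Evec d → Evec d)
    (w : SIdx m M → Fin s → ℝ) (H : SIdx m M → Fin s → Evec d) :
    ∑ rc, ∑ κ ∈ states s rc, w κ.1 κ.2 • nodeFun a b rc (H κ.1 κ.2) =
      (∑ j, w .det j • a (H .det j)) +
        ∑ j, ∑ r, ∑ μ, w (.sto r μ) j • b r (H (.sto r μ) j) := by
  rw [Fintype.sum_option, sum_states_none]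
  simp only [sum_states_some]
  congr 1
  refine (sum_congr rfl fun r _ => sum_comm).trans ?_
  exact sum_comm

theorem StageEq.eq_smul {c : SRK m s M} {a : Evec d → Evec d} {b : Fin m → Evec d → Evec d}
    {y0 : Evec d} {u : ℝ} {θ : Mbar M → ℝ} {H : SIdx m M → Fin s → Evec d}
    (h : StageEq c a b y0 (u • θ) H) (p : SIdx m M) (i : Fin s) :
    H p i = y0 + u • ∑ rc, ∑ κ ∈ states s rc,
      c.Z θ p κ.1 i κ.2 • nodeFun a b rc (H κ.1 κ.2) := by
  rw [h p i, add_assoc, ← sum_states_eq a b fun p' j => c.Z (u • θ) p p' i j]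
  simp only [SRK.Z_smul, smul_sum, smul_smul]

theorem oneStep_eq_smul (c : SRK m s M) (a : Evec d → Evec d) (b : Fin m → Evec d → Evec d)
    (y0 : Evec d) (u : ℝ) (θ : Mbar M → ℝ) (H : SIdx m M → Fin s → Evec d) :
    oneStep c a b y0 (u • θ) H = y0 + u • ∑ rc, ∑ κ ∈ states s rc,
      c.z θ κ.1 κ.2 • nodeFun a b rc (H κ.1 κ.2) := by
  rw [oneStep, add_assoc, ← sum_states_eq a b fun p j => c.z (u • θ) p j]
  simp only [SRK.z_smul, smul_sum, smul_smul]

theorem SRK.contDiff_z (c : SRK m s M) (n : ℕ) (p : SIdx m M) (i : Fin s) :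
    ContDiff ℝ n fun θ => c.z θ p i := by
  cases p <;> simp only [SRK.z] <;> fun_prop

theorem contDiffOn_oneStep {N : ℕ} (c : SRK m s M) {a : Evec d → Evec d}
    {b : Fin m → Evec d → Evec d} (hab : ∀ rc, ContDiff ℝ N (nodeFun a b rc)) (y0 : Evec d)
    {H : (Mbar M → ℝ) → SIdx m M → Fin s → Evec d} {U : Set (Mbar M → ℝ)}
    (hH : ∀ p i, ContDiffOn ℝ N (fun θ => H θ p i) U) :
    ContDiffOn ℝ N (fun θ => oneStep c a b y0 θ (H θ)) U := by
  have hterm : ∀ rc p i, ContDiffOn ℝ N (fun θ => c.z θ p i • nodeFun a b rc (H θ p i)) U :=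
    fun rc p i => (c.contDiff_z N p i).contDiffOn.smul ((hab rc).comp_contDiffOn (hH p i))
  refine (contDiffOn_const.add (ContDiffOn.sum fun i _ => hterm none .det i)).add ?_
  exact ContDiffOn.sum fun i _ => ContDiffOn.sum fun k _ => ContDiffOn.sum fun ν _ =>
    hterm (some k) (.sto k ν) i

/-- Differentiating a curve of the form `y0 + u • ∑ w κ • b^{rc} (h κ u)` at `u = 0`. -/
theorem iteratedDeriv_succ_of_eventuallyEq {N : ℕ} {a : Evec d → Evec d}
    {b : Fin m → Evec d → Evec d} (hab : ∀ rc, ContDiff ℝ N (nodeFun a b rc))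
    {h : SIdx m M × Fin s → ℝ → Evec d} (hh : ∀ κ, ContDiffAt ℝ N (h κ) 0) {y0 : Evec d}
    {w : SIdx m M × Fin s → ℝ} {f : ℝ → Evec d}
    (hf : ∀ᶠ u in nhds 0, f u = y0 + u • ∑ rc, ∑ κ ∈ states s rc, w κ • nodeFun a b rc (h κ u))
    {n : ℕ} (hn : n + 1 ≤ N) :
    iteratedDeriv (n + 1) f 0 = ((n + 1 : ℕ) : ℝ) • ∑ rc, ∑ κ ∈ states s rc,
      w κ • iteratedDeriv n (fun u => nodeFun a b rc (h κ u)) 0 := by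
  have hsmooth : ∀ rc κ, ContDiffAt ℝ (n + 1 : ℕ) (fun u => nodeFun a b rc (h κ u)) 0 :=
    fun rc κ => ((hab rc).contDiffAt.comp (0 : ℝ) (hh κ)).of_le (by exact_mod_cast hn)
  have hterm : ∀ rc κ, ContDiffAt ℝ (n + 1 : ℕ) (fun u => w κ • nodeFun a b rc (h κ u)) 0 :=
    fun rc κ => ContDiffAt.smul (f := fun _ => w κ) contDiffAt_const (hsmooth rc κ)
  have hinner : ∀ rc, ContDiffAt ℝ (n + 1 : ℕ)
      (fun u => ∑ κ ∈ states s rc, w κ • nodeFun a b rc (h κ u)) 0 :=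
    fun rc => ContDiffAt.sum fun κ _ => hterm rc κ
  have hle : ((n : ℕ) : WithTop ℕ∞) ≤ (n + 1 : ℕ) := by norm_cast; lia
  have hf' : f =ᶠ[nhds 0] fun u => y0 + u • ∑ rc, ∑ κ ∈ states s rc,
    w κ • nodeFun a b rc (h κ u) := hf
  rw [hf'.iteratedDeriv_eq, iteratedDeriv_const_add (by lia),
    iteratedDeriv_succ_id_smul (ContDiffAt.sum fun rc _ => hinner rc),
    iteratedDeriv_fun_sum fun rc _ => (hinner rc).of_le hle]
  congr 1
  refine sum_congr rfl fun rc _ => ?_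
  rw [iteratedDeriv_fun_sum fun κ _ => (hterm rc κ).of_le hle]
  exact sum_congr rfl fun κ _ => iteratedDeriv_fun_const_smul ((hsmooth rc κ).of_le hle) _

theorem treesOn_univ_zero (l m : ℕ) : treesOn m (univ : Finset (Fin l)) 0 = univ := by
  refine eq_univ_of_forall fun t => mem_treesOn.2 ⟨fun i _ => ?_, fun i hi => absurd (mem_univ i) hi⟩
  rcases Fin.eq_zero_or_eq_succ (t.father i) with h | ⟨j, h⟩
  · exact Or.inl h
  · exact Or.inr ⟨j, mem_univ j, h⟩

theorem ZPhi_eq_sum_states (c : SRK m s M) (θ : Mbar M → ℝ) (p : SIdx m M) (i : Fin s)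
    (rc : Option (Fin m)) {l : ℕ} (t : STree l m) :
    ZPhi c θ p i rc t = ∑ κ ∈ states s rc,
      c.Z θ p κ.1 i κ.2 * ∏ j ∈ t.child 0, PsiN c θ t j κ.1 κ.2 := by
  cases rc with
  | none => rw [sum_states_none]; rfl
  | some r => rw [sum_states_some]; rfl

theorem zPhi_eq_sum_states (c : SRK m s M) (θ : Mbar M → ℝ)
    (rc : Option (Fin m)) {l : ℕ} (t : STree l m) :
    zPhi c θ rc t = ∑ κ ∈ states s rc,
      c.z θ κ.1 κ.2 * ∏ j ∈ t.child 0, PsiN c θ t j κ.1 κ.2 := by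
  cases rc with
  | none => rw [sum_states_none]; rfl
  | some r => rw [sum_states_some]; rfl

theorem treeTerm_univ_zero (c : SRK m s M) (θ : Mbar M → ℝ) (a : Evec d → Evec d)
    (b : Fin m → Evec d → Evec d) (y0 : Evec d) (rc : Option (Fin m)) {l : ℕ} (t : STree l m)
    (κ : SIdx m M × Fin s) :
    treeTerm c θ a b y0 (nodeFun a b rc) t univ 0 κ =
      ((∏ j ∈ t.child 0, (t.densNode j : ℝ)) * ∏ j ∈ t.child 0, PsiN c θ t j κ.1 κ.2) •
        elemFRootV a b rc t y0 := by
  rw [treeTerm, treeWeight, prod_mul_distrib]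
  rfl

theorem smul_sum_treeTerm_univ (c : SRK m s M) (θ : Mbar M → ℝ) (a : Evec d → Evec d)
    (b : Fin m → Evec d → Evec d) (y0 : Evec d) (q : ℕ) (w : SIdx m M × Fin s → ℝ) (J : Fin d) :
    (((q + 1 : ℕ) : ℝ) • ∑ rc, ∑ κ ∈ states s rc, w κ • ∑ t ∈ treesOn m (univ : Finset (Fin q)) 0,
      treeTerm c θ a b y0 (nodeFun a b rc) t univ 0 κ) J =
    ∑ rc, ∑ t : STree q m, (t.densR : ℝ) *
      (∑ κ ∈ states s rc, w κ * ∏ j ∈ t.child 0, PsiN c θ t j κ.1 κ.2) *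
        elemFRootV a b rc t y0 J := by
  simp only [treesOn_univ_zero, treeTerm_univ_zero, PiLp.smul_apply, WithLp.ofLp_sum,
    Finset.sum_apply, smul_eq_mul, mul_sum, sum_mul]
  refine sum_congr rfl fun rc _ => ?_
  rw [sum_comm]
  refine sum_congr rfl fun t _ => sum_congr rfl fun κ _ => ?_
  rw [STree.densR]
  push_cast
  ring

end Stages

/-- Representation of the `D^q`-derivatives of the SRK stages and of the
numerical solution by rooted trees (here `q+1` plays the role of `q ≥ 1`; trees in
`STree q m` have `q+1` nodes). -/
theorem srk_derivatives_by_rooted_trees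
    (d m s q : ℕ) (M : Type) [Fintype M] [DecidableEq M]
    (c : SRK m s M)
    (a : Evec d → Evec d) (b : Fin m → Evec d → Evec d)
    (ha : ContDiff ℝ (q+1) a) (hb : ∀ k, ContDiff ℝ (q+1) (b k))
    (y0 : Evec d) (θh : Mbar M → ℝ)
    (H : (Mbar M → ℝ) → SIdx m M → Fin s → Evec d)
    (U : Set (Mbar M → ℝ)) (hU : IsOpen U) (h0U : (0 : Mbar M → ℝ) ∈ U)
    (hsm : ∀ (p : SIdx m M) (i : Fin s), ContDiffOn ℝ (q+1) (fun θ => H θ p i) U)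
    (hstage : ∀ θ ∈ U, StageEq c a b y0 θ (H θ))
    (hzero : ∀ (p : SIdx m M) (i : Fin s), H 0 p i = y0) :
    (∀ (p : SIdx m M) (i : Fin s) (J : Fin d),
      Dq (q+1) θh (fun θ => H θ p i J) 0 =
        ∑ rc : Option (Fin m), ∑ t : STree q m,
          (t.densR : ℝ) * ZPhi c θh p i rc t * elemFRootV a b rc t y0 J)
    ∧ ∀ J : Fin d,
      Dq (q+1) θh (fun θ => oneStep c a b y0 θ (H θ) J) 0 =
        ∑ rc : Option (Fin m), ∑ t : STree q m,
          (t.densR : ℝ) * zPhi c θh rc t * elemFRootV a b rc t y0 J := by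
  have hab : ∀ rc, ContDiff ℝ (q + 1 : ℕ) (nodeFun a b rc) := by
    rintro (_ | k)
    · exact_mod_cast ha
    · exact_mod_cast hb k
  have hsm' : ∀ p i, ContDiffOn ℝ (q + 1 : ℕ) (fun θ => H θ p i) U := fun p i => by
    exact_mod_cast hsm p i
  have hUnhds : ∀ᶠ u : ℝ in nhds 0, u • θh ∈ U :=
    (continuous_id.smul continuous_const).continuousAt.preimage_mem_nhds
      (hU.mem_nhds (by simpa using h0U))
  have hcurve : ∀ {f : (Mbar M → ℝ) → Evec d}, ContDiffOn ℝ (q + 1 : ℕ) f U →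
      ContDiffAt ℝ (q + 1 : ℕ) (fun u : ℝ => f (u • θh)) 0 := fun {f} hf => by
    have h0 : ContDiffAt ℝ (q + 1 : ℕ) f ((0 : ℝ) • θh) := by
      rw [zero_smul]
      exact hf.contDiffAt (hU.mem_nhds h0U)
    exact h0.comp (0 : ℝ) (contDiff_id.smul contDiff_const).contDiffAt
  have hDq : ∀ {f : (Mbar M → ℝ) → Evec d}, ContDiffOn ℝ (q + 1 : ℕ) f U → ∀ J,
      Dq (q + 1) θh (fun θ => f θ J) 0 = iteratedDeriv (q + 1) (fun u : ℝ => f (u • θh)) 0 J :=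
    fun {f} hf J => by
      have hfJ : ContDiffOn ℝ (q + 1 : ℕ) (fun θ => f θ J) U :=
        (EuclideanSpace.proj (𝕜 := ℝ) J).contDiff.comp_contDiffOn hf
      rw [Dq_zero_eq_iteratedDeriv θh hU h0U hfJ]
      exact iteratedDeriv_coord (hcurve hf) J
  have hh : ∀ κ : SIdx m M × Fin s,
      ContDiffAt ℝ (q + 1 : ℕ) (fun u : ℝ => H (u • θh) κ.1 κ.2) 0 := fun κ =>
    hcurve (hsm' κ.1 κ.2)
  have hstage' : ∀ κ : SIdx m M × Fin s, ∀ᶠ u : ℝ in nhds 0, H (u • θh) κ.1 κ.2 =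
      y0 + u • ∑ rc, ∑ κ' ∈ states s rc,
        c.Z θh κ.1 κ'.1 κ.2 κ'.2 • nodeFun a b rc (H (u • θh) κ'.1 κ'.2) := fun κ =>
    hUnhds.mono fun u hu => (hstage _ hu).eq_smul κ.1 κ.2
  have hnode : ∀ rc (κ : SIdx m M × Fin s),
      iteratedDeriv q (fun u : ℝ => nodeFun a b rc (H (u • θh) κ.1 κ.2)) 0 =
        ∑ t ∈ treesOn m (univ : Finset (Fin q)) 0,
          treeTerm c θh a b y0 (nodeFun a b rc) t univ 0 κ := fun rc =>
    iteratedDeriv_comp_eq_sum_treeTerm c θh a b y0 (q + 1) hab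
      (fun κ u => H (u • θh) κ.1 κ.2) hh (fun κ => by simpa using hzero κ.1 κ.2)
      (fun n hn κ => iteratedDeriv_succ_of_eventuallyEq hab hh (hstage' κ) hn) q
      (card_fin q) (Nat.le_succ q) (fun i _ => Fin.zero_le _)
      ((hab rc).of_le (by norm_cast; lia))
  have hderiv : ∀ {f : ℝ → Evec d} {w : SIdx m M × Fin s → ℝ},
      (∀ᶠ u in nhds 0, f u = y0 + u • ∑ rc, ∑ κ ∈ states s rc,
        w κ • nodeFun a b rc (H (u • θh) κ.1 κ.2)) → ∀ J,
      iteratedDeriv (q + 1) f 0 J = ∑ rc, ∑ t : STree q m, (t.densR : ℝ) *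
        (∑ κ ∈ states s rc, w κ * ∏ j ∈ t.child 0, PsiN c θh t j κ.1 κ.2) *
          elemFRootV a b rc t y0 J := fun {f w} hf J => by
    rw [iteratedDeriv_succ_of_eventuallyEq hab hh hf le_rfl, ← smul_sum_treeTerm_univ]
    simp only [hnode]
  refine ⟨fun p i J => ?_, fun J => ?_⟩
  · rw [hDq (hsm' p i), hderiv (hstage' (p, i))]
    simp only [ZPhi_eq_sum_states]
  · rw [hDq (contDiffOn_oneStep c hab y0 hsm'),
      hderiv (Filter.Eventually.of_forall fun u => oneStep_eq_smul c a b y0 u θh _)]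
    simp only [zPhi_eq_sum_states]

end SRKPaper
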